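/- Let φ : ℝ → ℝ be measurable, essentially bounded, eventually essentially monotone, and suppose the a.e. limits lim_{x→∞} φ(x) and lim_{x→−∞} φ(x) exist and are distinct. Then for every ϱ ≠ 0, the Lebesgue integral ∫_ℝ Δ¹_ϱ[φ](x) dx is nonzero. -/

import Mathlib

open MeasureTheory Set Filter
open scoped ENNReal NNReal

noncomputable section

/-- The first difference operator with step `ϱ`. -/
def DeltaOp (ϱ : ℝ) (f : ℝ → ℝ) : ℝ → ℝ := fun x => f (x + ϱ) - f x

/-- `φ` is essentially bounded (bounded outside a Lebesgue-null set). -/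
def EssBounded (φ : ℝ → ℝ) : Prop :=
  ∃ C : ℝ, ∀ᵐ x ∂(volume : Measure ℝ), |φ x| ≤ C

/-- `φ` is monotone (nondecreasing or nonincreasing) on `s`. -/
def MonoOrAntiOn (φ : ℝ → ℝ) (s : Set ℝ) : Prop :=
  MonotoneOn φ s ∨ AntitoneOn φ s

/-- `φ` is eventually essentially monotone. -/
def EventuallyEssMonotone (φ : ℝ → ℝ) : Prop :=
  ∃ X > (0 : ℝ), ∃ Z : Set ℝ, volume Z = 0 ∧
    MonoOrAntiOn φ (Ioi X \ Z) ∧ MonoOrAntiOn φ (Iio (-X) \ Z)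

/-- `lim_{x → ∞} φ(x) = a` a.e. -/
def AELimAtTop (φ : ℝ → ℝ) (a : ℝ) : Prop :=
  ∃ Z : Set ℝ, volume Z = 0 ∧ Tendsto φ (atTop ⊓ Filter.principal Zᶜ) (nhds a)

/-- `lim_{x → -∞} φ(x) = b` a.e. -/
def AELimAtBot (φ : ℝ → ℝ) (b : ℝ) : Prop :=
  ∃ Z : Set ℝ, volume Z = 0 ∧ Tendsto φ (atBot ⊓ Filter.principal Zᶜ) (nhds b)

lemma ae_comp_add_right {p : ℝ → Prop} (h : ∀ᵐ x ∂(volume : Measure ℝ), p x) (c : ℝ) :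
    ∀ᵐ x ∂(volume : Measure ℝ), p (x + c) :=
  (measurePreserving_add_right volume c).quasiMeasurePreserving.ae h

lemma intervalIntegrable_of_ae_bound {φ : ℝ → ℝ} (hmeas : Measurable φ) {C : ℝ}
    (hC : ∀ᵐ x ∂(volume : Measure ℝ), |φ x| ≤ C) (s t : ℝ) :
    IntervalIntegrable φ volume s t := by
  rw [intervalIntegrable_iff]
  exact Measure.integrableOn_of_bounded (by simp) hmeas.aestronglyMeasurable
    (ae_restrict_of_ae hC)

lemma intervalIntegrable_deltaOp {φ : ℝ → ℝ} (hmeas : Measurable φ) {C : ℝ}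
    (hC : ∀ᵐ x ∂(volume : Measure ℝ), |φ x| ≤ C) (ϱ s t : ℝ) :
    IntervalIntegrable (DeltaOp ϱ φ) volume s t :=
  (intervalIntegrable_of_ae_bound (hmeas.comp (measurable_id.add_const ϱ))
    (ae_comp_add_right hC ϱ) s t).sub (intervalIntegrable_of_ae_bound hmeas hC s t)

/-- Integrating a difference over an interval telescopes to the two ends. -/
lemma intervalIntegral_deltaOp {φ : ℝ → ℝ} (hmeas : Measurable φ) {C : ℝ}
    (hC : ∀ᵐ x ∂(volume : Measure ℝ), |φ x| ≤ C) (ϱ s t : ℝ) :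
    ∫ x in s..t, DeltaOp ϱ φ x = (∫ x in t..t + ϱ, φ x) - ∫ x in s..s + ϱ, φ x := by
  have hφ := intervalIntegrable_of_ae_bound hmeas hC
  have hsub : ∫ x in s..t, DeltaOp ϱ φ x
      = (∫ x in s..t, φ (x + ϱ)) - ∫ x in s..t, φ x :=
    intervalIntegral.integral_sub
      (intervalIntegrable_of_ae_bound (hmeas.comp (measurable_id.add_const ϱ))
        (ae_comp_add_right hC ϱ) s t) (hφ s t)
  rw [hsub, intervalIntegral.integral_comp_add_right]
  have h₁ := intervalIntegral.integral_add_adjacent_intervals (hφ s (s + ϱ)) (hφ (s + ϱ) (t + ϱ))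
  have h₂ := intervalIntegral.integral_add_adjacent_intervals (hφ s t) (hφ t (t + ϱ))
  linarith

lemma abs_intervalIntegral_deltaOp_le {φ : ℝ → ℝ} (hmeas : Measurable φ) {C : ℝ}
    (hC : ∀ᵐ x ∂(volume : Measure ℝ), |φ x| ≤ C) (ϱ s t : ℝ) :
    |∫ x in s..t, DeltaOp ϱ φ x| ≤ 2 * (C * |ϱ|) := by
  have hwindow : ∀ r : ℝ, |∫ x in r..r + ϱ, φ x| ≤ C * |ϱ| := fun r => by
    have := intervalIntegral.norm_integral_le_of_norm_le_const_ae
      (a := r) (b := r + ϱ) (f := φ) (C := C) (hC.mono fun x hx _ => hx)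
    simpa using this
  rw [intervalIntegral_deltaOp hmeas hC]
  linarith [abs_sub (∫ x in t..t + ϱ, φ x) (∫ x in s..s + ϱ, φ x), hwindow s, hwindow t]

lemma MonoOrAntiOn.ae_deltaOp_sign {φ : ℝ → ℝ} {S Z : Set ℝ} (hZ : volume Z = 0)
    (h : MonoOrAntiOn φ (S \ Z)) (ϱ : ℝ) :
    (∀ᵐ x ∂(volume : Measure ℝ), x ∈ S → x + ϱ ∈ S → 0 ≤ DeltaOp ϱ φ x) ∨
      ∀ᵐ x ∂(volume : Measure ℝ), x ∈ S → x + ϱ ∈ S → DeltaOp ϱ φ x ≤ 0 := by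
  have hZ' : ∀ᵐ x ∂(volume : Measure ℝ), x ∉ Z := measure_eq_zero_iff_ae_notMem.1 hZ
  have hZϱ := ae_comp_add_right hZ' ϱ
  unfold DeltaOp
  rcases h with h | h <;> rcases le_total 0 ϱ with hϱ | hϱ
  · left
    filter_upwards [hZ', hZϱ] with x hx hxϱ hS hSϱ
    exact sub_nonneg.2 (h ⟨hS, hx⟩ ⟨hSϱ, hxϱ⟩ (by linarith))
  · right
    filter_upwards [hZ', hZϱ] with x hx hxϱ hS hSϱ
    exact sub_nonpos.2 (h ⟨hSϱ, hxϱ⟩ ⟨hS, hx⟩ (by linarith))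
  · right
    filter_upwards [hZ', hZϱ] with x hx hxϱ hS hSϱ
    exact sub_nonpos.2 (h ⟨hS, hx⟩ ⟨hSϱ, hxϱ⟩ (by linarith))
  · left
    filter_upwards [hZ', hZϱ] with x hx hxϱ hS hSϱ
    exact sub_nonneg.2 (h ⟨hSϱ, hxϱ⟩ ⟨hS, hx⟩ (by linarith))

lemma intervalIntegral_norm_eq_abs_of_ae_sign {f : ℝ → ℝ} {s t : ℝ} (hst : s ≤ t)
    (h : (∀ᵐ x ∂(volume : Measure ℝ), x ∈ Ioc s t → 0 ≤ f x) ∨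
      ∀ᵐ x ∂(volume : Measure ℝ), x ∈ Ioc s t → f x ≤ 0) :
    ∫ x in s..t, ‖f x‖ = |∫ x in s..t, f x| := by
  have hnonneg : 0 ≤ ∫ x in s..t, ‖f x‖ :=
    intervalIntegral.integral_nonneg hst fun x _ => norm_nonneg _
  rw [← abs_of_nonneg hnonneg]
  rcases h with h | h
  · congr 1
    refine intervalIntegral.integral_congr_ae ?_
    rw [uIoc_of_le hst]
    filter_upwards [h] with x hx hxst
    exact abs_of_nonneg (hx hxst)
  · rw [← abs_neg (∫ x in s..t, f x), ← intervalIntegral.integral_neg]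
    congr 1
    refine intervalIntegral.integral_congr_ae ?_
    rw [uIoc_of_le hst]
    filter_upwards [h] with x hx hxst
    exact abs_of_nonpos (hx hxst)

lemma intervalIntegral_norm_deltaOp_le {φ : ℝ → ℝ} (hmeas : Measurable φ) {C : ℝ}
    (hC : ∀ᵐ x ∂(volume : Measure ℝ), |φ x| ≤ C) {S Z : Set ℝ} (hZ : volume Z = 0)
    (h : MonoOrAntiOn φ (S \ Z)) {ϱ s t : ℝ} (hst : s ≤ t)
    (hS : ∀ x ∈ Ioc s t, x ∈ S ∧ x + ϱ ∈ S) :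
    ∫ x in s..t, ‖DeltaOp ϱ φ x‖ ≤ 2 * (C * |ϱ|) := by
  rw [intervalIntegral_norm_eq_abs_of_ae_sign hst]
  · exact abs_intervalIntegral_deltaOp_le hmeas hC ϱ s t
  · exact (h.ae_deltaOp_sign hZ ϱ).imp
      (fun h => h.mono fun x hx hxs => hx (hS x hxs).1 (hS x hxs).2)
      (fun h => h.mono fun x hx hxs => hx (hS x hxs).1 (hS x hxs).2)

lemma integrable_deltaOp {φ : ℝ → ℝ} (hmeas : Measurable φ) (hbd : EssBounded φ)
    (hmono : EventuallyEssMonotone φ) (ϱ : ℝ) : Integrable (DeltaOp ϱ φ) volume := by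
  obtain ⟨C, hC⟩ := hbd
  obtain ⟨X, hX, Z, hZ, hright, hleft⟩ := hmono
  have hint := intervalIntegrable_deltaOp hmeas hC ϱ
  have hϱ₁ := neg_abs_le ϱ
  have hϱ₂ := le_abs_self ϱ
  have hϱ₀ := abs_nonneg ϱ
  set Y := X + |ϱ| with hY
  have hIoi : IntegrableOn (DeltaOp ϱ φ) (Ioi Y) := by
    refine integrableOn_Ioi_of_intervalIntegral_norm_bounded (l := atTop) (b := id)
      (2 * (C * |ϱ|)) Y (fun t => (hint Y t).1) tendsto_id ?_
    filter_upwards [eventually_ge_atTop Y] with t ht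
    refine intervalIntegral_norm_deltaOp_le hmeas hC hZ hright ht fun x hx => ?_
    have := hx.1
    exact ⟨mem_Ioi.2 (by linarith), mem_Ioi.2 (by linarith)⟩
  have hIic : IntegrableOn (DeltaOp ϱ φ) (Iic (-Y - 1)) := by
    refine integrableOn_Iic_of_intervalIntegral_norm_bounded (l := atBot) (a := id)
      (2 * (C * |ϱ|)) (-Y - 1) (fun t => (hint t (-Y - 1)).1) tendsto_id ?_
    filter_upwards [eventually_le_atBot (-Y - 1)] with t ht
    refine intervalIntegral_norm_deltaOp_le hmeas hC hZ hleft ht fun x hx => ?_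
    have := hx.2
    exact ⟨mem_Iio.2 (by linarith), mem_Iio.2 (by linarith)⟩
  have hunion := (hIic.union (hint (-Y - 1) Y).1).union hIoi
  rwa [Iic_union_Ioc_eq_Iic (by linarith), Iic_union_Ioi, integrableOn_univ] at hunion

lemma tendsto_intervalIntegral_window {φ : ℝ → ℝ} (hmeas : Measurable φ) {C : ℝ}
    (hC : ∀ᵐ x ∂(volume : Measure ℝ), |φ x| ≤ C) {F : Filter ℝ} {Z : Set ℝ} {c : ℝ}
    (hZ : volume Z = 0) (hlim : Tendsto φ (F ⊓ 𝓟 Zᶜ) (nhds c)) {u : ℕ → ℝ}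
    (hu : ∀ x, Tendsto (fun n => x + u n) atTop F) (ϱ : ℝ) :
    Tendsto (fun n => ∫ x in u n..u n + ϱ, φ x) atTop (nhds (ϱ * c)) := by
  have hshift : ∀ n, ∫ x in u n..u n + ϱ, φ x = ∫ x in (0 : ℝ)..ϱ, φ (x + u n) := fun n => by
    rw [intervalIntegral.integral_comp_add_right, zero_add, add_comm ϱ]
  have hconst : ϱ * c = ∫ _ in (0 : ℝ)..ϱ, c := by simp
  simp_rw [hshift]
  rw [hconst]
  refine intervalIntegral.tendsto_integral_filter_of_dominated_convergence (fun _ => C)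
    (Eventually.of_forall fun n =>
      (hmeas.comp (measurable_id.add_const (u n))).aestronglyMeasurable)
    (Eventually.of_forall fun n => (ae_comp_add_right hC (u n)).mono fun x hx _ => hx)
    intervalIntegrable_const ?_
  have hZ' : ∀ᵐ x ∂(volume : Measure ℝ), ∀ n, x + u n ∉ Z :=
    ae_all_iff.2 fun n => ae_comp_add_right (measure_eq_zero_iff_ae_notMem.1 hZ) (u n)
  filter_upwards [hZ'] with x hx _
  exact hlim.comp (tendsto_inf.2 ⟨hu x, tendsto_principal.2 (Eventually.of_forall hx)⟩)

theorem integral_deltaOp {φ : ℝ → ℝ} (hmeas : Measurable φ) (hbd : EssBounded φ)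
    (hmono : EventuallyEssMonotone φ) {a b : ℝ} (ha : AELimAtTop φ a) (hb : AELimAtBot φ b)
    (ϱ : ℝ) : ∫ x, DeltaOp ϱ φ x ∂(volume : Measure ℝ) = ϱ * (a - b) := by
  have hint := integrable_deltaOp hmeas hbd hmono ϱ
  obtain ⟨C, hC⟩ := hbd
  obtain ⟨Za, hZa, ha⟩ := ha
  obtain ⟨Zb, hZb, hb⟩ := hb
  have htop : Tendsto (fun n : ℕ => (n : ℝ)) atTop atTop := tendsto_natCast_atTop_atTop
  have hbot : Tendsto (fun n : ℕ => -(n : ℝ)) atTop atBot := tendsto_neg_atTop_atBot.comp htop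
  have hright := tendsto_intervalIntegral_window hmeas hC hZa ha
    (fun x => tendsto_atTop_add_const_left _ x htop) ϱ
  have hleft := tendsto_intervalIntegral_window hmeas hC hZb hb
    (fun x => tendsto_atBot_add_const_left _ x hbot) ϱ
  have hall := intervalIntegral_tendsto_integral hint hbot htop
  simp_rw [intervalIntegral_deltaOp hmeas hC] at hall
  rw [mul_sub]
  exact tendsto_nhds_unique hall (hright.sub hleft)

theorem delta_integral_ne_zero (φ : ℝ → ℝ) (hmeas : Measurable φ) (hbd : EssBounded φ)
    (hmono : EventuallyEssMonotone φ) (a b : ℝ)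
    (ha : AELimAtTop φ a) (hb : AELimAtBot φ b) (hab : a ≠ b)
    (ϱ : ℝ) (hϱ : ϱ ≠ 0) :
    ∫ x, DeltaOp ϱ φ x ∂(volume : Measure ℝ) ≠ 0 := by
  rw [integral_deltaOp hmeas hbd hmono ha hb]
  exact mul_ne_zero hϱ (sub_ne_zero.2 hab)
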